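/- Let C be a Q-category and let S, S' : 𝒮 → ob(C) and W, W' : 𝒮 → Q be functions with W'(c) ≤ W(c) for every c ∈ 𝒮. If the weighted meets ⋀^W S and ⋀^{W'} S' exist, then ⨅_{c∈𝒮} hom_C(S(c), S'(c)) ≤ hom_C(⋀^W S, ⋀^{W'} S'). -/

import Mathlib

/- `Q` is a commutative unital quantale: `[CommMonoid Q] [CompleteLattice Q] [IsQuantale Q]`
(Mathlib's `IsQuantale` says multiplication distributes over arbitrary suprema).
Semicartesianness (`∀ p q, p * q ≤ p ⊓ q`) is taken as an explicit hypothesis where needed. -/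

universe u v w

/-- The internal hom `[p,q] := ⨆ {r | p·r ≤ q}` of a quantale. -/
def qhom {Q : Type v} [CompleteLattice Q] [Mul Q] (p q : Q) : Q := sSup {r | p * r ≤ q}

section QCat

variable {Q : Type v} [CompleteLattice Q] [CommMonoid Q] {A : Type u}

/-- A `Q`-category structure on `A` given by a `Q`-valued hom. -/
structure IsQCategory (hom : A → A → Q) : Prop where
  hom_self : ∀ x, hom x x = 1
  comp : ∀ x y z, hom x y * hom y z ≤ hom x z

/-- `m` is the meet of `S` weighted by `W`. -/
def IsWeightedMeet (hom : A → A → Q) {ι : Type w} (S : ι → A) (W : ι → Q) (m : A) : Prop :=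
  ∀ x, hom x m = ⨅ c, qhom (W c) (hom x (S c))

/-- `j` is the join of `S` weighted by `W`. -/
def IsWeightedJoin (hom : A → A → Q) {ι : Type w} (S : ι → A) (W : ι → Q) (j : A) : Prop :=
  ∀ x, hom j x = ⨅ c, qhom (W c) (hom (S c) x)

/-- The `Q`-category has all weighted meets. -/
def HasAllWeightedMeets (hom : A → A → Q) : Prop :=
  ∀ (ι : Type u) (S : ι → A) (W : ι → Q), ∃ m, IsWeightedMeet hom S W m

/-- The `Q`-category has all weighted joins. -/
def HasAllWeightedJoins (hom : A → A → Q) : Prop :=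
  ∀ (ι : Type u) (S : ι → A) (W : ι → Q), ∃ j, IsWeightedJoin hom S W j

end QCat

/-- The adjunction between multiplication and the internal hom. -/
theorem le_qhom_iff {Q : Type v} [CompleteLattice Q] [CommMonoid Q] [IsQuantale Q] {p q r : Q} :
    r ≤ qhom p q ↔ p * r ≤ q := by
  refine ⟨fun h => ?_, fun h => le_sSup h⟩
  calc p * r ≤ p * qhom p q := mul_le_mul_right h p
    _ = ⨆ s ∈ {s | p * s ≤ q}, p * s := IsQuantale.mul_sSup_distrib _ _
    _ ≤ q := iSup₂_le fun _ hs => hs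

/-- The weights are bounded by the homs out of a weighted meet. -/
theorem IsWeightedMeet.weight_le_hom {Q : Type v} [CompleteLattice Q] [CommMonoid Q] [IsQuantale Q]
    {A : Type u} {hom : A → A → Q} (hC : IsQCategory hom) {ι : Type w} {S : ι → A} {W : ι → Q}
    {m : A} (hm : IsWeightedMeet hom S W m) (c : ι) : W c ≤ hom m (S c) := by
  have h : (1 : Q) ≤ qhom (W c) (hom m (S c)) := by
    rw [← hC.hom_self m, hm m]
    exact iInf_le _ c
  simpa using le_qhom_iff.1 h

/-- If `W' ≤ W` pointwise, then
`⨅_c hom (S c) (S' c) ≤ hom (⋀^W S) (⋀^{W'} S')`. -/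
theorem weighted_meet_hom_bound
    {Q : Type v} [CompleteLattice Q] [CommMonoid Q] [IsQuantale Q]
    (hsc : ∀ p q : Q, p * q ≤ p ⊓ q)
    {A : Type u} {hom : A → A → Q} (hC : IsQCategory hom)
    {ι : Type w} (S S' : ι → A) (W W' : ι → Q) (hW : ∀ c, W' c ≤ W c)
    (m m' : A) (hm : IsWeightedMeet hom S W m) (hm' : IsWeightedMeet hom S' W' m') :
    (⨅ c, hom (S c) (S' c)) ≤ hom m m' := by
  rw [hm' m]
  refine le_iInf fun c => le_qhom_iff.2 ?_
  calc W' c * ⨅ c, hom (S c) (S' c) ≤ hom m (S c) * hom (S c) (S' c) :=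
        mul_le_mul' ((hW c).trans (hm.weight_le_hom hC c)) (iInf_le _ c)
    _ ≤ hom m (S' c) := hC.comp _ _ _
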